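/- Let N ≥ 2, T > 0, L ≥ 0, let p_1,…,p_N : closure(Q_T) → ℝ be Lipschitz continuous with p_i(z) > 2N/(N+2) and |∂_t p_i| ≤ L almost everywhere in Q_T, let ε ∈ (0,1), and let f be smooth on closure(Q_T). Then for every ρ ∈ (0,1) there exist constants C and C', depending on ρ, L, T, N, a and the bounds of the p_i but not on ε, u or f, such that every classical solution u of the regularized anisotropic equation satisfies: ‖u_t‖²_{2,Q_T} + Σ_{i=1}^N sup_{t∈(0,T)} ∫_{K_a} (1/p_i(x,t)) (ε² + |D_i u|²)^{p_i(x,t)/2} dx ≤ C ( 1 + ‖f‖²_{2,Q_T} + Σ_{i=1}^N ∫_{K_a} |D_i u(x,0)|^{p_i(x,0)} dx ) + C' Σ_{i=1}^N ∫_{Q_T} |D_i u|^{p_i(z)+ρ} dz. -/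

import Mathlib

noncomputable section
open MeasureTheory Real

/-- The open parallelepiped `K_a = {x : |x_i| < a_i}`. -/
def Ka {N : ℕ} (a : Fin N → ℝ) : Set (Fin N → ℝ) := {x | ∀ i, |x i| < a i}

/-- The `i`-th partial derivative `D_i`. -/
def Dop {N : ℕ} (i : Fin N) (f : (Fin N → ℝ) → ℝ) : (Fin N → ℝ) → ℝ :=
  fun x => fderiv ℝ f x (Pi.single i 1)

/-- The energy density. -/
def Phi (ε q s : ℝ) : ℝ := (1 / q) * (ε ^ 2 + s ^ 2) ^ (q / 2)

/-- The flux. -/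
def Flux (ε q s : ℝ) : ℝ := (ε ^ 2 + s ^ 2) ^ ((q - 2) / 2) * s

/-- The derivative of the energy density in the exponent. -/
def PhiQ (ε q s : ℝ) : ℝ :=
  (1 / q) * (log (ε ^ 2 + s ^ 2) * (1 / 2) * (ε ^ 2 + s ^ 2) ^ (q / 2))
    - (1 / q ^ 2) * (ε ^ 2 + s ^ 2) ^ (q / 2)

theorem m_pos {ε : ℝ} (hε : 0 < ε) (s : ℝ) : 0 < ε ^ 2 + s ^ 2 := by positivity

theorem hasDerivAt_Phi {ε : ℝ} (hε : 0 < ε) {q s : ℝ → ℝ} {q' s' t : ℝ}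
    (hq : HasDerivAt q q' t) (hs : HasDerivAt s s' t) (hq0 : 0 < q t) :
    HasDerivAt (fun τ => Phi ε (q τ) (s τ))
      (PhiQ ε (q t) (s t) * q' + Flux ε (q t) (s t) * s') t := by
  have hm := m_pos hε (s t)
  have h1 : HasDerivAt (fun τ => ε ^ 2 + (s τ) ^ 2) (2 * s t * s') t := by
    refine ((hs.pow 2).const_add (ε ^ 2)).congr_deriv ?_
    push_cast
    ring
  have h2 := h1.rpow (hq.div_const 2) hm
  have h3 := (hq.inv hq0.ne').mul h2
  unfold Phi
  have e : (fun τ => 1 / q τ * (ε ^ 2 + (s τ) ^ 2) ^ (q τ / 2)) =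
      (q⁻¹ * fun τ => (ε ^ 2 + (s τ) ^ 2) ^ (q τ / 2)) := by
    ext τ; simp
  rw [e]
  refine h3.congr_deriv ?_
  have e2 : (q t - 2) / 2 = q t / 2 - 1 := by ring
  unfold PhiQ Flux
  rw [e2]
  simp only [Pi.inv_apply]
  field_simp
  ring

theorem m_bound {ε P : ℝ} (hε : ε ∈ Set.Ioo (0 : ℝ) 1) {r s : ℝ} (hr : 0 ≤ r) (hrP : r ≤ P) :
    (ε ^ 2 + s ^ 2) ^ (r / 2) ≤ 2 ^ P * (1 + |s| ^ r) := by
  have hm := m_pos hε.1 s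
  have hε1 : ε ^ 2 ≤ 1 := by nlinarith [hε.1, hε.2]
  have h2 : (2 : ℝ) ^ (r / 2) ≤ 2 ^ P :=
    Real.rpow_le_rpow_of_exponent_le (by norm_num) (by linarith)
  have hsr : 0 ≤ |s| ^ r := by positivity
  have h2P : (0 : ℝ) < 2 ^ P := by positivity
  rcases le_total |s| 1 with h | h
  · have : ε ^ 2 + s ^ 2 ≤ 2 := by
      have : s ^ 2 ≤ 1 := by rw [← sq_abs]; nlinarith [abs_nonneg s]
      linarith
    calc (ε ^ 2 + s ^ 2) ^ (r / 2) ≤ 2 ^ (r / 2) :=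
          Real.rpow_le_rpow hm.le this (by linarith)
      _ ≤ 2 ^ P := h2
      _ ≤ _ := by nlinarith
  · have : ε ^ 2 + s ^ 2 ≤ 2 * |s| ^ 2 := by
      have : 1 ≤ |s| ^ 2 := by nlinarith
      rw [← sq_abs s]
      linarith
    calc (ε ^ 2 + s ^ 2) ^ (r / 2) ≤ (2 * |s| ^ 2) ^ (r / 2) :=
          Real.rpow_le_rpow hm.le this (by linarith)
      _ = 2 ^ (r / 2) * |s| ^ r := by
          rw [Real.mul_rpow (by norm_num) (by positivity), ← Real.rpow_natCast |s| 2,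
            ← Real.rpow_mul (abs_nonneg s)]
          congr 2
          push_cast
          ring
      _ ≤ 2 ^ P * |s| ^ r := by gcongr
      _ ≤ _ := by nlinarith

theorem Phi_nonneg {ε : ℝ} (hε : 0 < ε) {q s : ℝ} (hq : 0 < q) : 0 ≤ Phi ε q s := by
  have hm := m_pos hε s
  unfold Phi
  positivity

theorem Phi_bound {ε P : ℝ} (hε : ε ∈ Set.Ioo (0 : ℝ) 1) {q s : ℝ} (hq : 1 ≤ q) (hqP : q ≤ P) :
    Phi ε q s ≤ 2 ^ P * (1 + |s| ^ q) := by
  have hm := m_pos hε.1 s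
  refine le_trans ?_ (m_bound hε (by linarith) hqP)
  unfold Phi
  have : 1 / q ≤ 1 := by rw [div_le_one (by linarith)]; exact hq
  have h0 : 0 ≤ (ε ^ 2 + s ^ 2) ^ (q / 2) := by positivity
  nlinarith

theorem PhiQ_bound {ε P ρ : ℝ} (hε : ε ∈ Set.Ioo (0 : ℝ) 1) (hρ : ρ ∈ Set.Ioo (0 : ℝ) 1)
    {q s : ℝ} (hq : 1 ≤ q) (hqP : q ≤ P) :
    |PhiQ ε q s| ≤ (3 + (1 + 1 / ρ) * 2 ^ (P + 1)) * (1 + |s| ^ (q + ρ)) := by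
  have hm := m_pos hε.1 s
  have hb := m_bound (s := s) hε (r := q + ρ) (P := P + 1)
    (by linarith [hρ.1]) (by linarith [hρ.2])
  unfold PhiQ
  set m := ε ^ 2 + s ^ 2 with hmdef
  have hρ0 := hρ.1
  have hq0 : 0 < q := by linarith
  have hA : 0 ≤ m ^ (q / 2) := by positivity
  have hB : 0 ≤ m ^ ((q + ρ) / 2) := by positivity
  have k1 : |log m| * m ^ (q / 2) ≤ 2 + 2 / ρ * m ^ ((q + ρ) / 2) := by
    rcases le_total m 1 with h | h
    · have := Real.abs_log_mul_self_rpow_lt m (q / 2) hm h (by linarith)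
      rw [abs_mul, abs_of_nonneg hA] at this
      have h3 : 1 / (q / 2) ≤ 2 := by
        rw [div_le_iff₀ (by linarith)]; linarith
      have : 0 ≤ 2 / ρ * m ^ ((q + ρ) / 2) := by positivity
      linarith
    · have h4 := Real.log_le_rpow_div hm.le (ε := ρ / 2) (by linarith)
      rw [abs_of_nonneg (Real.log_nonneg h)]
      have h5 : m ^ ((q + ρ) / 2) = m ^ (ρ / 2) * m ^ (q / 2) := by
        rw [← Real.rpow_add hm]; congr 1; ring
      rw [h5]
      have h6 : m ^ (ρ / 2) / (ρ / 2) = 2 / ρ * m ^ (ρ / 2) := by field_simp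
      rw [h6] at h4
      nlinarith
  have k2 : m ^ (q / 2) ≤ 1 + m ^ ((q + ρ) / 2) := by
    rcases le_total m 1 with h | h
    · have := Real.rpow_le_one hm.le h (z := q / 2) (by linarith)
      linarith
    · have := Real.rpow_le_rpow_of_exponent_le h (y := q / 2) (z := (q + ρ) / 2) (by linarith)
      linarith
  have hq1 : 1 / q ≤ 1 := by rw [div_le_one (by linarith)]; exact hq
  have hq2 : 1 / q ^ 2 ≤ 1 := by rw [div_le_one (by positivity)]; nlinarith
  have hlog := mul_nonneg (abs_nonneg (log m)) hA
  have k3 : |1 / q * (log m * (1 / 2) * m ^ (q / 2)) - 1 / q ^ 2 * m ^ (q / 2)|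
      ≤ |log m| * m ^ (q / 2) * (1 / 2) + m ^ (q / 2) := by
    refine (abs_sub _ _).trans (add_le_add ?_ ?_)
    · rw [abs_mul, abs_mul, abs_mul, abs_of_nonneg hA, abs_of_pos (by positivity : 0 < 1 / q),
        abs_of_pos (by norm_num : (0 : ℝ) < 1 / 2)]
      nlinarith
    · rw [abs_mul, abs_of_nonneg hA, abs_of_pos (by positivity : 0 < 1 / q ^ 2)]
      nlinarith
  have k4 : (1 + 1 / ρ) * m ^ ((q + ρ) / 2) ≤
      (1 + 1 / ρ) * (2 ^ (P + 1) * (1 + |s| ^ (q + ρ))) := by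
    gcongr
  have k5 : 2 / ρ = 2 * (1 / ρ) := by ring
  rw [k5] at k1
  have k6 : 0 ≤ |s| ^ (q + ρ) := by positivity
  nlinarith

theorem contDiff_m (ε : ℝ) : ContDiff ℝ 1 (fun w : ℝ × ℝ => ε ^ 2 + w.2 ^ 2) :=
  contDiff_const.add (contDiff_snd.pow 2)

theorem contDiff_FluxPair {ε : ℝ} (hε : 0 < ε) :
    ContDiff ℝ 1 (fun w : ℝ × ℝ => Flux ε w.1 w.2) := by
  have h1 : ContDiff ℝ 1 (fun w : ℝ × ℝ => (w.1 - 2) / 2) :=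
    (contDiff_fst.sub contDiff_const).div_const 2
  have h2 := (contDiff_m ε).rpow h1 (fun w => (m_pos hε w.2).ne')
  exact h2.mul contDiff_snd

theorem contDiffOn_PhiPair {ε : ℝ} (hε : 0 < ε) :
    ContDiffOn ℝ 1 (fun w : ℝ × ℝ => Phi ε w.1 w.2) {w | 0 < w.1} := by
  have h1 : ContDiff ℝ 1 (fun w : ℝ × ℝ => w.1 / 2) := contDiff_fst.div_const 2
  have h2 := (contDiff_m ε).rpow h1 (fun w => (m_pos hε w.2).ne')
  have h3 : ContDiffOn ℝ 1 (fun w : ℝ × ℝ => 1 / w.1) {w | 0 < w.1} :=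
    contDiffOn_const.div contDiff_fst.contDiffOn (fun w hw => ne_of_gt hw)
  exact h3.mul h2.contDiffOn

theorem continuousOn_rpow_m {X : Type*} [TopologicalSpace X] {S : Set X} {ε : ℝ} (hε : 0 < ε)
    {q s : X → ℝ} (hq : ContinuousOn q S) (hs : ContinuousOn s S) :
    ContinuousOn (fun x => (ε ^ 2 + s x ^ 2) ^ (q x)) S := by
  have hm : ∀ x ∈ S, ε ^ 2 + s x ^ 2 ≠ 0 := fun x _ => (m_pos hε (s x)).ne'
  have h1 : ContinuousOn (fun x => ε ^ 2 + s x ^ 2) S := continuousOn_const.add (hs.pow 2)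
  exact h1.rpow hq (fun x hx => Or.inl (hm x hx))

theorem continuousOn_Flux {X : Type*} [TopologicalSpace X] {S : Set X} {ε : ℝ} (hε : 0 < ε)
    {q s : X → ℝ} (hq : ContinuousOn q S) (hs : ContinuousOn s S) :
    ContinuousOn (fun x => Flux ε (q x) (s x)) S :=
  (continuousOn_rpow_m hε ((hq.sub continuousOn_const).div_const 2) hs).mul hs

theorem continuousOn_Phi {X : Type*} [TopologicalSpace X] {S : Set X} {ε : ℝ} (hε : 0 < ε)
    {q s : X → ℝ} (hq : ContinuousOn q S) (hs : ContinuousOn s S) (h0 : ∀ x ∈ S, 0 < q x) :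
    ContinuousOn (fun x => Phi ε (q x) (s x)) S :=
  (continuousOn_const.div hq (fun x hx => (h0 x hx).ne')).mul
    (continuousOn_rpow_m hε (hq.div_const 2) hs)

theorem continuousOn_PhiQ {X : Type*} [TopologicalSpace X] {S : Set X} {ε : ℝ} (hε : 0 < ε)
    {q s : X → ℝ} (hq : ContinuousOn q S) (hs : ContinuousOn s S) (h0 : ∀ x ∈ S, 0 < q x) :
    ContinuousOn (fun x => PhiQ ε (q x) (s x)) S := by
  have hm : ∀ x ∈ S, ε ^ 2 + s x ^ 2 ≠ 0 := fun x _ => (m_pos hε (s x)).ne'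
  have h1 : ContinuousOn (fun x => ε ^ 2 + s x ^ 2) S := by fun_prop
  have h2 : ContinuousOn (fun x => (ε ^ 2 + s x ^ 2) ^ (q x / 2)) S :=
    h1.rpow (by fun_prop) (fun x hx => Or.inl (hm x hx))
  have h3 : ContinuousOn (fun x => 1 / q x) S :=
    continuousOn_const.div hq (fun x hx => (h0 x hx).ne')
  have h4 : ContinuousOn (fun x => 1 / q x ^ 2) S :=
    continuousOn_const.div (hq.pow 2) (fun x hx => (pow_pos (h0 x hx) 2).ne')
  have h5 : ContinuousOn (fun x => log (ε ^ 2 + s x ^ 2)) S := h1.log hm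
  unfold PhiQ
  exact (h3.mul ((h5.mul continuousOn_const).mul h2)).sub (h4.mul h2)

theorem Ka_eq {N : ℕ} (a : Fin N → ℝ) :
    Ka a = Set.pi Set.univ (fun i => Set.Ioo (-(a i)) (a i)) := by
  ext x
  simp [Ka, abs_lt]

theorem Ka_open {N : ℕ} (a : Fin N → ℝ) : IsOpen (Ka a) := by
  rw [Ka_eq]
  exact isOpen_set_pi Set.finite_univ (fun i _ => isOpen_Ioo)

theorem Ka_convex {N : ℕ} (a : Fin N → ℝ) : Convex ℝ (Ka a) := by
  rw [Ka_eq]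
  exact convex_pi (fun i _ => convex_Ioo _ _)

theorem Ka_compact {N : ℕ} (a : Fin N → ℝ) : IsCompact (closure (Ka a)) := by
  apply Bornology.IsBounded.isCompact_closure
  rw [Ka_eq]
  exact Bornology.IsBounded.pi (fun i => Metric.isBounded_Ioo _ _)

theorem Ka_zero_mem {N : ℕ} (a : Fin N → ℝ) (ha : ∀ i, 0 < a i) : (0 : Fin N → ℝ) ∈ Ka a := by
  intro i
  simpa using ha i

/-- Extension by zero of a Lipschitz function vanishing on the frontier. -/
theorem lip_extend_zero {N : ℕ} {K : Set (Fin N → ℝ)} {g : (Fin N → ℝ) → ℝ} {C : NNReal}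
    (hg : LipschitzOnWith C g (closure K)) (hg0 : ∀ x ∈ frontier K, g x = 0) :
    LipschitzWith C ((closure K).indicator g) := by
  have key : ∀ x ∈ closure K, ∀ y ∉ closure K, |g x| ≤ C * dist x y := by
    intro x hx y hy
    have hc : IsPreconnected (segment ℝ x y) := (convex_segment x y).isPreconnected
    have : (segment ℝ x y ∩ frontier (closure K)).Nonempty := by
      by_contra hne
      rw [Set.not_nonempty_iff_eq_empty] at hne
      rcases hc.subset_or_subset (isOpen_interior (s := closure K))
        (isClosed_closure (s := K)).isOpen_compl
        (Set.disjoint_left.2 fun z hz hz' => hz' (interior_subset hz)) (by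
          intro z hz
          by_cases hzK : z ∈ closure K
          · left
            by_contra hzi
            have : z ∈ segment ℝ x y ∩ frontier (closure K) :=
              ⟨hz, by rw [frontier, closure_closure]; exact ⟨hzK, hzi⟩⟩
            rw [hne] at this
            exact this
          · right; exact hzK) with h | h
      · exact hy (interior_subset (h (right_mem_segment ℝ x y)))
      · exact h (left_mem_segment ℝ x y) hx
    obtain ⟨w, hw, hwf⟩ := this
    have hwf' : w ∈ frontier K := frontier_closure_subset hwf
    have hwK : w ∈ closure K := frontier_subset_closure hwf'
    have h1 := hg.dist_le_mul x hx w hwK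
    rw [hg0 w hwf', dist_zero_right, Real.norm_eq_abs] at h1
    refine h1.trans ?_
    gcongr
    rw [dist_comm, dist_comm x y, dist_eq_norm, dist_eq_norm]
    exact norm_sub_le_of_mem_segment hw
  refine LipschitzWith.of_dist_le_mul fun x y => ?_
  by_cases hx : x ∈ closure K <;> by_cases hy : y ∈ closure K
  · rw [Set.indicator_of_mem hx, Set.indicator_of_mem hy]
    exact hg.dist_le_mul x hx y hy
  · rw [Set.indicator_of_mem hx, Set.indicator_of_notMem hy, dist_zero_right]
    exact key x hx y hy
  · rw [Set.indicator_of_notMem hx, Set.indicator_of_mem hy, dist_zero_left, dist_comm]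
    exact key y hy x hx
  · rw [Set.indicator_of_notMem hx, Set.indicator_of_notMem hy, dist_self]
    positivity

theorem ibp {N : ℕ} {K : Set (Fin N → ℝ)} (hKo : IsOpen K) (hKc : Convex ℝ K)
    (hKb : IsCompact (closure K)) {F g g' : (Fin N → ℝ) → ℝ} {C C' : NNReal}
    (hF : LipschitzOnWith C F (closure K)) (hg : LipschitzOnWith C' g (closure K))
    (hg0 : ∀ x ∈ frontier K, g x = 0) (e : Fin N → ℝ)
    (hg' : ∀ x ∈ K, HasLineDerivAt ℝ g (g' x) x e) :
    IntegrableOn (fun x => fderiv ℝ F x e * g x) K ∧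
      ∫ x in K, fderiv ℝ F x e * g x = - ∫ x in K, F x * g' x := by
  obtain ⟨F', hF', hFF'⟩ := hF.extend_real
  have hG := lip_extend_zero hg hg0
  set G := (closure K).indicator g with hGdef
  have hGs : HasCompactSupport G :=
    HasCompactSupport.intro hKb (fun x hx => Set.indicator_of_notMem hx g)
  have hmain := hF'.integral_lineDeriv_mul_eq hG hGs e (μ := volume)
  -- the left hand side
  have hGK : ∀ x ∈ K, G x = g x := fun x hx => Set.indicator_of_mem (subset_closure hx) g
  have hGz : ∀ x ∉ K, G x = 0 := by
    intro x hx
    by_cases hxc : x ∈ closure K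
    · rw [hGdef, Set.indicator_of_mem hxc]
      exact hg0 x ⟨hxc, by rwa [hKo.interior_eq]⟩
    · exact Set.indicator_of_notMem hxc g
  have hae : ∀ᵐ x ∂(volume.restrict K), lineDeriv ℝ F' x e * G x = fderiv ℝ F x e * g x := by
    rw [ae_restrict_iff' hKo.measurableSet]
    filter_upwards [hF'.ae_differentiableAt (μ := volume)] with x hx hxK
    rw [hx.lineDeriv_eq_fderiv, hGK x hxK]
    congr 2
    apply Filter.EventuallyEq.fderiv_eq
    filter_upwards [hKo.mem_nhds hxK] with y hy
    exact (hFF' (subset_closure hy)).symm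
  have hint : Integrable (fun x => lineDeriv ℝ F' x e * G x) := by
    have := (hG.continuous.integrable_of_hasCompactSupport hGs (μ := volume))
    have h2 := this.essSup_smul (hF'.memLp_lineDeriv e (μ := volume)).aestronglyMeasurable
      (hF'.memLp_lineDeriv e (μ := volume)).2.ne
    exact h2
  have hL : ∫ x, lineDeriv ℝ F' x e * G x = ∫ x in K, fderiv ℝ F x e * g x := by
    rw [← integral_congr_ae hae, setIntegral_eq_integral_of_forall_compl_eq_zero]
    intro x hx
    rw [hGz x hx, mul_zero]
  have hR : ∫ x, lineDeriv ℝ G x (-e) * F' x = - ∫ x in K, F x * g' x := by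
    have hfr : ∀ᵐ x ∂(volume : Measure (Fin N → ℝ)), x ∉ frontier K := by
      rw [ae_iff]
      simpa using hKc.addHaar_frontier volume
    have h1 : ∫ x, lineDeriv ℝ G x (-e) * F' x = ∫ x in K, lineDeriv ℝ G x (-e) * F' x := by
      rw [← integral_indicator hKo.measurableSet]
      apply integral_congr_ae
      filter_upwards [hfr] with x hx
      by_cases hxK : x ∈ K
      · rw [Set.indicator_of_mem hxK]
      · rw [Set.indicator_of_notMem hxK]
        have hxc : x ∉ closure K := fun h => hx ⟨h, by rwa [hKo.interior_eq]⟩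
        have : lineDeriv ℝ G x (-e) = lineDeriv ℝ (fun _ => (0 : ℝ)) x (-e) := by
          apply Filter.EventuallyEq.lineDeriv_eq
          filter_upwards [isClosed_closure.isOpen_compl.mem_nhds hxc] with y hy
          exact Set.indicator_of_notMem hy g
        rw [this]
        simp [lineDeriv]
    rw [h1, ← integral_neg]
    apply setIntegral_congr_fun hKo.measurableSet
    intro x hx
    simp only
    have : HasLineDerivAt ℝ G (g' x) x e := by
      apply (hg' x hx).congr_of_eventuallyEq
      filter_upwards [hKo.mem_nhds hx] with y hy
      exact hGK y hy
    rw [lineDeriv_neg, this.lineDeriv, ← hFF' (subset_closure hx)]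
    ring
  refine ⟨(hint.integrableOn).congr hae, ?_⟩
  rw [← hL, hmain, hR]

theorem oneD {ε : ℝ} (hε : 0 < ε) {T L τ : ℝ} (hτ : τ ∈ Set.Ioc 0 T)
    {q s s' : ℝ → ℝ} (hL : 0 ≤ L)
    (hq : ∀ t ∈ Set.Icc 0 T, ∀ r ∈ Set.Icc 0 T, |q t - q r| ≤ L * |t - r|)
    (hq1 : ∀ t ∈ Set.Icc 0 T, 1 ≤ q t)
    {C : NNReal} (hs : LipschitzOnWith C s (Set.Icc 0 T))
    (hs' : ∀ t ∈ Set.Ioo 0 T, HasDerivAt s (s' t) t)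
    (hs'c : ContinuousOn s' (Set.Icc 0 T)) :
    Phi ε (q τ) (s τ) - Phi ε (q 0) (s 0) ≤
      ∫ t in Set.Ioo 0 τ, (Flux ε (q t) (s t) * s' t + L * |PhiQ ε (q t) (s t)|) := by
  have hsub : Set.Icc 0 τ ⊆ Set.Icc 0 T := Set.Icc_subset_Icc le_rfl hτ.2
  have hqL : LipschitzOnWith ⟨L, hL⟩ q (Set.Icc 0 T) := by
    refine LipschitzOnWith.of_dist_le_mul fun x hx y hy => ?_
    exact hq x hx y hy
  obtain ⟨P, hP⟩ := isCompact_Icc.exists_bound_of_continuousOn hqL.continuousOn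
  obtain ⟨M, hM⟩ := isCompact_Icc.exists_bound_of_continuousOn hs.continuousOn
  have hcv : Convex ℝ (Set.Icc (1 : ℝ) P ×ˢ Set.Icc (-M) M) :=
    (convex_Icc _ _).prod (convex_Icc _ _)
  obtain ⟨K, hK⟩ := ((contDiffOn_PhiPair hε).mono (s := {w | 0 < w.1})
    (t := Set.Icc (1 : ℝ) P ×ˢ Set.Icc (-M) M)
    (fun w hw => lt_of_lt_of_le one_pos hw.1.1)).exists_lipschitzOnWith one_ne_zero hcv
    (isCompact_Icc.prod isCompact_Icc)
  have hmaps : Set.MapsTo (fun t => (q t, s t)) (Set.Icc 0 T)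
      (Set.Icc (1 : ℝ) P ×ˢ Set.Icc (-M) M) := by
    intro t ht
    exact ⟨⟨hq1 t ht, (le_abs_self _).trans (hP t ht)⟩, abs_le.1 (hM t ht)⟩
  have hlip := (hK.comp (hqL.prodMk hs) hmaps).mono hsub
  rw [← Set.uIcc_of_le hτ.1.le] at hlip
  have hac := hlip.absolutelyContinuousOnInterval
  have hftc := hac.integral_deriv_eq_sub
  have hint := hac.intervalIntegrable_deriv
  simp only [Function.comp_def] at hftc hint
  rw [intervalIntegrable_iff_integrableOn_Ioo_of_le hτ.1.le] at hint
  rw [intervalIntegral.integral_of_le hτ.1.le, integral_Ioc_eq_integral_Ioo] at hftc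
  rw [← hftc]
  have hpos : ∀ t ∈ Set.Icc 0 T, 0 < q t := fun t ht => lt_of_lt_of_le one_pos (hq1 t ht)
  refine integral_mono_ae hint ?_ ?_
  · have : ContinuousOn (fun t => Flux ε (q t) (s t) * s' t + L * |PhiQ ε (q t) (s t)|)
        (Set.Icc 0 T) :=
      ((continuousOn_Flux hε hqL.continuousOn hs.continuousOn).mul hs'c).add
        (continuousOn_const.mul
          (continuousOn_PhiQ hε hqL.continuousOn hs.continuousOn hpos).abs)
    exact (this.integrableOn_compact isCompact_Icc).mono_set
      (Set.Ioo_subset_Icc_self.trans hsub)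
  · rw [Filter.EventuallyLE, ae_restrict_iff' measurableSet_Ioo]
    filter_upwards [hqL.ae_differentiableWithinAt_of_mem_of_real (μ := volume)] with t ht htt
    have htI : t ∈ Set.Ioo 0 T := ⟨htt.1, lt_of_lt_of_le htt.2 hτ.2⟩
    have hn : Set.Icc 0 T ∈ nhds t := Icc_mem_nhds htI.1 htI.2
    have hd := ((ht (Set.Ioo_subset_Icc_self htI)).differentiableAt hn).hasDerivAt
    have := hasDerivAt_Phi hε hd (hs' t htI) (hpos t (Set.Ioo_subset_Icc_self htI))
    rw [this.deriv]
    have hdb : |deriv q t| ≤ L := by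
      exact norm_deriv_le_of_lipschitzOn hn hqL
    have h1 : PhiQ ε (q t) (s t) * deriv q t ≤ L * |PhiQ ε (q t) (s t)| := by
      refine (le_abs_self _).trans ?_
      rw [abs_mul, mul_comm]
      gcongr
    linarith

/-- The closed space-time cylinder. -/
def SS {N : ℕ} (a : Fin N → ℝ) (T : ℝ) : Set ((Fin N → ℝ) × ℝ) :=
  closure (Ka a) ×ˢ Set.Icc 0 T

theorem SS_convex {N : ℕ} (a : Fin N → ℝ) (T : ℝ) : Convex ℝ (SS a T) :=
  (Ka_convex a).closure.prod (convex_Icc _ _)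

theorem SS_compact {N : ℕ} (a : Fin N → ℝ) (T : ℝ) : IsCompact (SS a T) :=
  (Ka_compact a).prod isCompact_Icc

theorem SS_interior {N : ℕ} (a : Fin N → ℝ) (T : ℝ) {x : Fin N → ℝ} {t : ℝ} (hx : x ∈ Ka a)
    (ht : t ∈ Set.Ioo 0 T) : (x, t) ∈ interior (SS a T) := by
  rw [SS, interior_prod_eq]
  refine ⟨?_, by rwa [interior_Icc]⟩
  exact mem_interior_iff_mem_nhds.2
    (Filter.mem_of_superset ((Ka_open a).mem_nhds hx) subset_closure)

theorem SS_uniq {N : ℕ} (a : Fin N → ℝ) (ha : ∀ i, 0 < a i) {T : ℝ} (hT : 0 < T) :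
    UniqueDiffOn ℝ (SS a T) :=
  uniqueDiffOn_convex (SS_convex a T)
    ⟨(0, T / 2), SS_interior a T (Ka_zero_mem a ha) ⟨by linarith, by linarith⟩⟩

/-- The derivative within the cylinder in direction `w`. -/
def Dv {N : ℕ} (a : Fin N → ℝ) (T : ℝ) (v : (Fin N → ℝ) × ℝ → ℝ) (w : (Fin N → ℝ) × ℝ) :
    (Fin N → ℝ) × ℝ → ℝ := fun z => fderivWithin ℝ v (SS a T) z w

theorem Dv_contDiffOn {N : ℕ} (a : Fin N → ℝ) (ha : ∀ i, 0 < a i) {T : ℝ} (hT : 0 < T)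
    {v : (Fin N → ℝ) × ℝ → ℝ} (hv : ContDiffOn ℝ (⊤ : ℕ∞) v (SS a T)) (w : (Fin N → ℝ) × ℝ) :
    ContDiffOn ℝ (⊤ : ℕ∞) (Dv a T v w) (SS a T) :=
  (hv.fderivWithin (SS_uniq a ha hT) (by simp)).clm_apply contDiffOn_const

theorem Dv_space {N : ℕ} (a : Fin N → ℝ) {T : ℝ}
    {v : (Fin N → ℝ) × ℝ → ℝ} (hv : ContDiffOn ℝ (⊤ : ℕ∞) v (SS a T))
    {x : Fin N → ℝ} (hx : x ∈ Ka a) {t : ℝ} (ht : t ∈ Set.Icc 0 T) :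
    HasFDerivAt (fun y => v (y, t))
      ((fderivWithin ℝ v (SS a T) (x, t)).comp (ContinuousLinearMap.inl ℝ (Fin N → ℝ) ℝ)) x := by
  have h1 : HasFDerivWithinAt v (fderivWithin ℝ v (SS a T) (x, t)) (SS a T) (x, t) :=
    (hv.differentiableOn (by simp) (x, t) ⟨subset_closure hx, ht⟩).hasFDerivWithinAt
  have h2 : HasFDerivWithinAt (fun y : Fin N → ℝ => (y, t))
      (ContinuousLinearMap.inl ℝ (Fin N → ℝ) ℝ) (Ka a) x :=
    (hasFDerivAt_prodMk_left x t).hasFDerivWithinAt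
  have h3 := HasFDerivWithinAt.comp x (g := v) (t := SS a T) h1 h2 (fun y hy => ⟨subset_closure hy, ht⟩)
  exact h3.hasFDerivAt ((Ka_open a).mem_nhds hx)

theorem Dv_time {N : ℕ} (a : Fin N → ℝ) {T : ℝ}
    {v : (Fin N → ℝ) × ℝ → ℝ} (hv : ContDiffOn ℝ (⊤ : ℕ∞) v (SS a T))
    {x : Fin N → ℝ} (hx : x ∈ closure (Ka a)) {t : ℝ} (ht : t ∈ Set.Ioo 0 T) :
    HasDerivAt (fun s => v (x, s)) (Dv a T v (0, 1) (x, t)) t := by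
  have ht' := Set.Ioo_subset_Icc_self ht
  have h1 : HasFDerivWithinAt v (fderivWithin ℝ v (SS a T) (x, t)) (SS a T) (x, t) :=
    (hv.differentiableOn (by simp) (x, t) ⟨hx, ht'⟩).hasFDerivWithinAt
  have h2 : HasFDerivWithinAt (fun s : ℝ => (x, s))
      (ContinuousLinearMap.inr ℝ (Fin N → ℝ) ℝ) (Set.Icc 0 T) t :=
    (hasFDerivAt_prodMk_right x t).hasFDerivWithinAt
  have h3 := HasFDerivWithinAt.comp t (g := v) (t := SS a T) h1 h2 (fun y hy => ⟨hx, hy⟩)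
  have h4 := (h3.hasFDerivAt (Icc_mem_nhds ht.1 ht.2)).hasDerivAt
  exact h4

theorem Dv_symm {N : ℕ} (a : Fin N → ℝ) (ha : ∀ i, 0 < a i) {T : ℝ} (hT : 0 < T)
    {v : (Fin N → ℝ) × ℝ → ℝ} (hv : ContDiffOn ℝ (⊤ : ℕ∞) v (SS a T))
    {x : Fin N → ℝ} (hx : x ∈ Ka a) {t : ℝ} (ht : t ∈ Set.Ioo 0 T) (w w' : (Fin N → ℝ) × ℝ) :
    Dv a T (Dv a T v w) w' (x, t) = Dv a T (Dv a T v w') w (x, t) := by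
  have hz : (x, t) ∈ SS a T := interior_subset (SS_interior a T hx ht)
  have hu := SS_uniq a ha hT
  have hd : DifferentiableWithinAt ℝ (fderivWithin ℝ v (SS a T)) (SS a T) (x, t) :=
    ((hv.fderivWithin (m := (⊤ : ℕ∞)) hu (by simp)).differentiableOn (by simp)) _ hz
  have key : ∀ w w', Dv a T (Dv a T v w) w' (x, t) =
      fderivWithin ℝ (fderivWithin ℝ v (SS a T)) (SS a T) (x, t) w' w := by
    intro w w'
    unfold Dv
    rw [fderivWithin_clm_apply (hu _ hz) hd (differentiableWithinAt_const w)]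
    simp
  rw [key, key]
  exact ((hv _ hz).isSymmSndFDerivWithinAt (by simp only [minSmoothness_of_isRCLikeNormedField]; exact WithTop.coe_le_coe.2 le_top) hu
    (subset_closure (SS_interior a T hx ht)) hz) w' w

theorem lip_space {N : ℕ} (a : Fin N → ℝ) {T : ℝ}
    {v : (Fin N → ℝ) × ℝ → ℝ} {C : NNReal} (hv : LipschitzOnWith C v (SS a T))
    {t : ℝ} (ht : t ∈ Set.Icc 0 T) : LipschitzOnWith C (fun y => v (y, t)) (closure (Ka a)) := by
  refine LipschitzOnWith.of_dist_le_mul fun x hx y hy => ?_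
  have := hv.dist_le_mul (x, t) ⟨hx, ht⟩ (y, t) ⟨hy, ht⟩
  simpa [Prod.dist_eq] using this

theorem lip_time {N : ℕ} (a : Fin N → ℝ) {T : ℝ}
    {v : (Fin N → ℝ) × ℝ → ℝ} {C : NNReal} (hv : LipschitzOnWith C v (SS a T))
    {x : Fin N → ℝ} (hx : x ∈ closure (Ka a)) :
    LipschitzOnWith C (fun s => v (x, s)) (Set.Icc 0 T) := by
  refine LipschitzOnWith.of_dist_le_mul fun s hs t ht => ?_
  have := hv.dist_le_mul (x, s) ⟨hx, hs⟩ (x, t) ⟨hx, ht⟩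
  simpa [Prod.dist_eq] using this

/-- Lipschitz continuity of the flux. -/
theorem lip_flux {X : Type*} [PseudoMetricSpace X] {S : Set X} (hS : IsCompact S) {ε : ℝ}
    (hε : 0 < ε) {q s : X → ℝ} {C C' : NNReal}
    (hq : LipschitzOnWith C q S) (hs : LipschitzOnWith C' s S) :
    ∃ C'' : NNReal, LipschitzOnWith C'' (fun x => Flux ε (q x) (s x)) S := by
  obtain ⟨P, hP⟩ := hS.exists_bound_of_continuousOn hq.continuousOn
  obtain ⟨M, hM⟩ := hS.exists_bound_of_continuousOn hs.continuousOn
  have hcv : Convex ℝ (Set.Icc (-P) P ×ˢ Set.Icc (-M) M) :=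
    (convex_Icc _ _).prod (convex_Icc _ _)
  obtain ⟨K, hK⟩ := ((contDiff_FluxPair hε).contDiffOn
    (s := Set.Icc (-P) P ×ˢ Set.Icc (-M) M)).exists_lipschitzOnWith one_ne_zero hcv
    (isCompact_Icc.prod isCompact_Icc)
  have hmaps : Set.MapsTo (fun t => (q t, s t)) S (Set.Icc (-P) P ×ˢ Set.Icc (-M) M) := by
    intro t ht
    exact ⟨abs_le.1 (hP t ht), abs_le.1 (hM t ht)⟩
  have h3 := hK.comp (hq.prodMk hs) hmaps
  simp only [Function.comp_def] at h3
  exact ⟨_, h3⟩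

/-- Continuous functions on the closed cylinder are integrable. -/
theorem integrable_SS {N : ℕ} (a : Fin N → ℝ) {T τ : ℝ} (hτ : τ ≤ T)
    {h : (Fin N → ℝ) × ℝ → ℝ} (hh : ContinuousOn h (SS a T)) :
    Integrable h ((volume.restrict (Ka a)).prod (volume.restrict (Set.Ioo 0 τ))) := by
  rw [Measure.prod_restrict]
  refine (hh.integrableOn_compact (μ := volume) (SS_compact a T)).mono_set ?_
  exact Set.prod_mono subset_closure
    (Set.Ioo_subset_Icc_self.trans (Set.Icc_subset_Icc le_rfl hτ))

theorem slice_cont {N : ℕ} (a : Fin N → ℝ) {T : ℝ}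
    {h : (Fin N → ℝ) × ℝ → ℝ} (hh : ContinuousOn h (SS a T)) {t : ℝ} (ht : t ∈ Set.Icc 0 T) :
    ContinuousOn (fun x => h (x, t)) (closure (Ka a)) :=
  hh.comp (by fun_prop) (fun x hx => ⟨hx, ht⟩)

theorem slice_int {N : ℕ} (a : Fin N → ℝ) {T : ℝ}
    {h : (Fin N → ℝ) × ℝ → ℝ} (hh : ContinuousOn h (SS a T)) {t : ℝ} (ht : t ∈ Set.Icc 0 T) :
    IntegrableOn (fun x => h (x, t)) (Ka a) :=
  ((slice_cont a hh ht).integrableOn_compact (Ka_compact a)).mono_set subset_closure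

theorem outer_int {N : ℕ} (a : Fin N → ℝ) {T τ : ℝ} (hτ : τ ≤ T)
    {h : (Fin N → ℝ) × ℝ → ℝ} (hh : ContinuousOn h (SS a T)) :
    IntegrableOn (fun t => ∫ x in Ka a, h (x, t)) (Set.Ioo 0 τ) :=
  (integrable_SS a hτ hh).integral_prod_right

/-- The spatial unit direction. -/
def ej {N : ℕ} (j : Fin N) : (Fin N → ℝ) × ℝ := (Pi.single j 1, 0)

theorem energy_j {N : ℕ} (a : Fin N → ℝ) (ha : ∀ i, 0 < a i) {T : ℝ} (hT : 0 < T)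
    {L : ℝ} (hL : 0 ≤ L) {q : ((Fin N → ℝ) × ℝ) → ℝ} (hqc : ContinuousOn q (SS a T))
    (hq1 : ∀ z ∈ SS a T, 1 ≤ q z)
    (hpt : ∀ x ∈ closure (Ka a), ∀ t ∈ Set.Icc 0 T, ∀ s ∈ Set.Icc 0 T,
      |q (x, t) - q (x, s)| ≤ L * |t - s|)
    {ε : ℝ} (hε : 0 < ε) {d : (Fin N → ℝ) × ℝ → ℝ}
    (hd : ContDiffOn ℝ (⊤ : ℕ∞) d (SS a T)) {τ : ℝ} (hτ : τ ∈ Set.Ioc 0 T) :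
    (∫ x in Ka a, Phi ε (q (x, τ)) (d (x, τ))) - (∫ x in Ka a, Phi ε (q (x, 0)) (d (x, 0))) ≤
      (∫ t in Set.Ioo 0 τ, ∫ x in Ka a, Flux ε (q (x, t)) (d (x, t)) * Dv a T d (0, 1) (x, t)) +
      L * ∫ t in Set.Ioo 0 τ, ∫ x in Ka a, |PhiQ ε (q (x, t)) (d (x, t))| := by
  have hpos : ∀ z ∈ SS a T, 0 < q z := fun z hz => lt_of_lt_of_le one_pos (hq1 z hz)
  have hdc := hd.continuousOn
  have hGc := (Dv_contDiffOn a ha hT hd (0, 1)).continuousOn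
  obtain ⟨C, hC⟩ := hd.exists_lipschitzOnWith (by simp) (SS_convex a T) (SS_compact a T)
  have hPhi : ContinuousOn (fun z => Phi ε (q z) (d z)) (SS a T) :=
    continuousOn_Phi hε hqc hdc hpos
  have hFl : ContinuousOn (fun z => Flux ε (q z) (d z) * Dv a T d (0, 1) z) (SS a T) :=
    (continuousOn_Flux hε hqc hdc).mul hGc
  have hPQ : ContinuousOn (fun z => |PhiQ ε (q z) (d z)|) (SS a T) :=
    (continuousOn_PhiQ hε hqc hdc hpos).abs
  have hsum : ContinuousOn (fun z => Flux ε (q z) (d z) * Dv a T d (0, 1) z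
      + L * |PhiQ ε (q z) (d z)|) (SS a T) := hFl.add (continuousOn_const.mul hPQ)
  have hτI : τ ∈ Set.Icc 0 T := ⟨hτ.1.le, hτ.2⟩
  have h0I : (0 : ℝ) ∈ Set.Icc 0 T := ⟨le_rfl, hT.le⟩
  rw [← integral_sub (slice_int a hPhi hτI) (slice_int a hPhi h0I)]
  have step1 : ∫ x in Ka a, (Phi ε (q (x, τ)) (d (x, τ)) - Phi ε (q (x, 0)) (d (x, 0))) ≤
      ∫ x in Ka a, ∫ t in Set.Ioo 0 τ, (Flux ε (q (x, t)) (d (x, t)) * Dv a T d (0, 1) (x, t)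
        + L * |PhiQ ε (q (x, t)) (d (x, t))|) := by
    refine setIntegral_mono_on ((slice_int a hPhi hτI).sub (slice_int a hPhi h0I))
      (integrable_SS a hτ.2 hsum).integral_prod_left (Ka_open a).measurableSet ?_
    intro x hx
    have hxc := subset_closure hx
    exact oneD (q := fun t => q (x, t)) (s := fun t => d (x, t))
      (s' := fun t => Dv a T d (0, 1) (x, t)) hε hτ hL (hpt x hxc)
      (fun t ht => hq1 _ ⟨hxc, ht⟩) (lip_time a hC hxc)
      (fun t ht => Dv_time a hd hxc ht)
      (hGc.comp (by fun_prop) (fun t ht => ⟨hxc, ht⟩))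
  refine step1.trans (le_of_eq ?_)
  rw [integral_integral_swap (f := fun x t => Flux ε (q (x, t)) (d (x, t)) *
    Dv a T d (0, 1) (x, t) + L * |PhiQ ε (q (x, t)) (d (x, t))|) (integrable_SS a hτ.2 hsum)]
  rw [← integral_const_mul, ← integral_add (outer_int a hτ.2 hFl)
    ((outer_int a hτ.2 hPQ).const_mul L)]
  refine setIntegral_congr_fun measurableSet_Ioo fun t ht => ?_
  have htI : t ∈ Set.Icc 0 T := ⟨ht.1.le, ht.2.le.trans hτ.2⟩
  try simp only
  rw [← integral_const_mul, ← integral_add (slice_int a hFl htI)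
    ((slice_int a hPQ htI).const_mul L)]

theorem flux_sum {N : ℕ} (a : Fin N → ℝ) (ha : ∀ i, 0 < a i) {T : ℝ} (hT : 0 < T)
    {p : Fin N → ((Fin N → ℝ) × ℝ) → ℝ}
    (hpLip : ∀ i, ∃ K : NNReal, LipschitzOnWith K (p i) (SS a T))
    {ε : ℝ} (hε : 0 < ε) {v f : (Fin N → ℝ) × ℝ → ℝ}
    (hv : ContDiffOn ℝ (⊤ : ℕ∞) v (SS a T))
    (hv0 : ∀ x ∈ frontier (Ka a), ∀ t ∈ Set.Icc 0 T, v (x, t) = 0)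
    {t : ℝ} (ht : t ∈ Set.Ioo 0 T)
    (hpde : ∀ x ∈ Ka a, Dv a T v (0, 1) (x, t) =
      (∑ j, fderiv ℝ (fun y => Flux ε (p j (y, t)) (Dv a T v (ej j) (y, t))) x (Pi.single j 1))
        + f (x, t)) :
    ∑ j, ∫ x in Ka a, Flux ε (p j (x, t)) (Dv a T v (ej j) (x, t)) *
        Dv a T (Dv a T v (ej j)) (0, 1) (x, t) =
      ∫ x in Ka a, (f (x, t) * Dv a T v (0, 1) (x, t) - Dv a T v (0, 1) (x, t) ^ 2) := by
  have htI := Set.Ioo_subset_Icc_self ht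
  have hDt := Dv_contDiffOn a ha hT hv (0, 1)
  obtain ⟨Cg, hCg⟩ := hDt.exists_lipschitzOnWith (by simp) (SS_convex a T) (SS_compact a T)
  have hg0 : ∀ x ∈ frontier (Ka a), Dv a T v (0, 1) (x, t) = 0 := by
    intro x hx
    have h1 := Dv_time a hv (frontier_subset_closure hx) ht
    have h2 : HasDerivAt (fun s => v (x, s)) 0 t := by
      apply (hasDerivAt_const t (0 : ℝ)).congr_of_eventuallyEq
      filter_upwards [Icc_mem_nhds ht.1 ht.2] with s hs
      exact hv0 x hx s hs
    exact h1.unique h2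
  have key : ∀ j, IntegrableOn (fun x => fderiv ℝ (fun y => Flux ε (p j (y, t))
        (Dv a T v (ej j) (y, t))) x (Pi.single j 1) * Dv a T v (0, 1) (x, t)) (Ka a) ∧
      ∫ x in Ka a, fderiv ℝ (fun y => Flux ε (p j (y, t))
        (Dv a T v (ej j) (y, t))) x (Pi.single j 1) * Dv a T v (0, 1) (x, t) =
      - ∫ x in Ka a, Flux ε (p j (x, t)) (Dv a T v (ej j) (x, t)) *
        Dv a T (Dv a T v (ej j)) (0, 1) (x, t) := by
    intro j
    obtain ⟨Kp, hKp⟩ := hpLip j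
    obtain ⟨Cd, hCd⟩ := (Dv_contDiffOn a ha hT hv (ej j)).exists_lipschitzOnWith (by simp)
      (SS_convex a T) (SS_compact a T)
    obtain ⟨CF, hCF⟩ := lip_flux (Ka_compact a) hε (lip_space a hKp htI) (lip_space a hCd htI)
    refine ibp (Ka_open a) (Ka_convex a) (Ka_compact a) hCF (lip_space a hCg htI) hg0 _ ?_
    intro x hx
    have h1 := (Dv_space a hDt hx htI).hasLineDerivAt (Pi.single j 1)
    rw [Dv_symm a ha hT hv hx ht]
    exact h1
  have h2 : ∑ j, ∫ x in Ka a, Flux ε (p j (x, t)) (Dv a T v (ej j) (x, t)) *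
        Dv a T (Dv a T v (ej j)) (0, 1) (x, t) =
      - ∫ x in Ka a, ∑ j, fderiv ℝ (fun y => Flux ε (p j (y, t))
        (Dv a T v (ej j) (y, t))) x (Pi.single j 1) * Dv a T v (0, 1) (x, t) := by
    rw [integral_finsetSum _ (fun j _ => (key j).1), ← Finset.sum_neg_distrib]
    refine Finset.sum_congr rfl fun j _ => ?_
    rw [(key j).2, neg_neg]
  rw [h2, ← integral_neg]
  refine setIntegral_congr_fun (Ka_open a).measurableSet fun x hx => ?_
  rw [← Finset.sum_mul, eq_sub_of_add_eq (hpde x hx).symm]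
  ring

theorem energy {N : ℕ} (a : Fin N → ℝ) (ha : ∀ i, 0 < a i) {T : ℝ} (hT : 0 < T)
    {L : ℝ} (hL : 0 ≤ L) {p : Fin N → ((Fin N → ℝ) × ℝ) → ℝ}
    (hpLip : ∀ i, ∃ K : NNReal, LipschitzOnWith K (p i) (SS a T))
    (hp1 : ∀ i, ∀ z ∈ SS a T, 1 ≤ p i z)
    (hpt : ∀ i, ∀ x ∈ closure (Ka a), ∀ t ∈ Set.Icc 0 T, ∀ s ∈ Set.Icc 0 T,
      |p i (x, t) - p i (x, s)| ≤ L * |t - s|)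
    {ε : ℝ} (hε : 0 < ε) {v f : (Fin N → ℝ) × ℝ → ℝ}
    (hv : ContDiffOn ℝ (⊤ : ℕ∞) v (SS a T)) (hf : ContinuousOn f (SS a T))
    (hv0 : ∀ x ∈ frontier (Ka a), ∀ t ∈ Set.Icc 0 T, v (x, t) = 0)
    (hpde : ∀ t ∈ Set.Ioo 0 T, ∀ x ∈ Ka a, Dv a T v (0, 1) (x, t) =
      (∑ j, fderiv ℝ (fun y => Flux ε (p j (y, t)) (Dv a T v (ej j) (y, t))) x (Pi.single j 1))
        + f (x, t)) {τ : ℝ} (hτ : τ ∈ Set.Ioc 0 T) :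
    (∑ j, ∫ x in Ka a, Phi ε (p j (x, τ)) (Dv a T v (ej j) (x, τ))) +
      (1 / 2) * (∫ t in Set.Ioo 0 τ, ∫ x in Ka a, Dv a T v (0, 1) (x, t) ^ 2) ≤
    (∑ j, ∫ x in Ka a, Phi ε (p j (x, 0)) (Dv a T v (ej j) (x, 0))) +
      (1 / 2) * (∫ t in Set.Ioo 0 T, ∫ x in Ka a, f (x, t) ^ 2) +
      L * ∑ j, ∫ t in Set.Ioo 0 T, ∫ x in Ka a,
        |PhiQ ε (p j (x, t)) (Dv a T v (ej j) (x, t))| := by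
  have hpc : ∀ j, ContinuousOn (p j) (SS a T) := fun j => (hpLip j).choose_spec.continuousOn
  have hpos : ∀ j, ∀ z ∈ SS a T, 0 < p j z := fun j z hz => lt_of_lt_of_le one_pos (hp1 j z hz)
  have hD := fun j => Dv_contDiffOn a ha hT hv (ej j)
  have hDt := (Dv_contDiffOn a ha hT hv (0, 1)).continuousOn
  have hsub : Set.Ioo 0 τ ⊆ Set.Ioo 0 T := Set.Ioo_subset_Ioo le_rfl hτ.2
  have hPQ : ∀ j, ContinuousOn (fun z => |PhiQ ε (p j z) (Dv a T v (ej j) z)|) (SS a T) :=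
    fun j => (continuousOn_PhiQ hε (hpc j) (hD j).continuousOn (hpos j)).abs
  have hFl : ∀ j, ContinuousOn (fun z => Flux ε (p j z) (Dv a T v (ej j) z) *
      Dv a T (Dv a T v (ej j)) (0, 1) z) (SS a T) := fun j =>
    (continuousOn_Flux hε (hpc j) (hD j).continuousOn).mul
      (Dv_contDiffOn a ha hT (hD j) (0, 1)).continuousOn
  have h1 := Finset.sum_le_sum fun j (_ : j ∈ Finset.univ) =>
    energy_j a ha hT hL (hpc j) (hp1 j) (hpt j) hε (hD j) hτ
  rw [Finset.sum_sub_distrib, Finset.sum_add_distrib, ← Finset.mul_sum,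
    ← integral_finsetSum _ (fun j _ => outer_int a hτ.2 (hFl j))] at h1
  have hDt2 : ContinuousOn (fun z => Dv a T v (0, 1) z ^ 2) (SS a T) := hDt.pow 2
  have hf2 : ContinuousOn (fun z => f z ^ 2) (SS a T) := hf.pow 2
  have h2 : ∫ t in Set.Ioo 0 τ, ∑ j, ∫ x in Ka a, Flux ε (p j (x, t)) (Dv a T v (ej j) (x, t)) *
        Dv a T (Dv a T v (ej j)) (0, 1) (x, t) ≤
      ∫ t in Set.Ioo 0 τ, ((1 / 2) * (∫ x in Ka a, f (x, t) ^ 2) -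
        (1 / 2) * ∫ x in Ka a, Dv a T v (0, 1) (x, t) ^ 2) := by
    refine setIntegral_mono_on
      (integrable_finsetSum _ (fun j _ => outer_int a hτ.2 (hFl j)))
      (((outer_int a hτ.2 hf2).const_mul _).sub ((outer_int a hτ.2 hDt2).const_mul _))
      measurableSet_Ioo ?_
    intro t ht
    have htT := hsub ht
    have htI := Set.Ioo_subset_Icc_self htT
    rw [flux_sum a ha hT hpLip hε hv hv0 htT (hpde t htT)]
    rw [← integral_const_mul, ← integral_const_mul,
      ← integral_sub ((slice_int a hf2 htI).const_mul _) ((slice_int a hDt2 htI).const_mul _)]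
    refine setIntegral_mono_on (slice_int a ((hf.mul hDt).sub hDt2) htI)
      (((slice_int a hf2 htI).const_mul _).sub ((slice_int a hDt2 htI).const_mul _))
      (Ka_open a).measurableSet ?_
    intro x hx
    nlinarith [sq_nonneg (f (x, t) - Dv a T v (0, 1) (x, t))]
  rw [integral_sub ((outer_int a hτ.2 hf2).const_mul _) ((outer_int a hτ.2 hDt2).const_mul _),
    integral_const_mul, integral_const_mul] at h2
  have h3 : ∫ t in Set.Ioo 0 τ, ∫ x in Ka a, f (x, t) ^ 2 ≤
      ∫ t in Set.Ioo 0 T, ∫ x in Ka a, f (x, t) ^ 2 := by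
    refine setIntegral_mono_set (outer_int a le_rfl hf2)
      (Filter.Eventually.of_forall fun t => integral_nonneg fun x => sq_nonneg _)
      hsub.eventuallyLE
  have h4 : ∑ j, ∫ t in Set.Ioo 0 τ, ∫ x in Ka a,
        |PhiQ ε (p j (x, t)) (Dv a T v (ej j) (x, t))| ≤
      ∑ j, ∫ t in Set.Ioo 0 T, ∫ x in Ka a,
        |PhiQ ε (p j (x, t)) (Dv a T v (ej j) (x, t))| := by
    refine Finset.sum_le_sum fun j _ => setIntegral_mono_set (outer_int a le_rfl (hPQ j))
      (Filter.Eventually.of_forall fun t => integral_nonneg fun x => abs_nonneg _)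
      hsub.eventuallyLE
  have h5 := mul_le_mul_of_nonneg_left h4 hL
  linarith

theorem stmt18 (N : ℕ) (hN : 2 ≤ N) (a : Fin N → ℝ) (ha : ∀ i, 0 < a i)
    (T : ℝ) (hT : 0 < T) (L : ℝ) (hL : 0 ≤ L)
    (p : Fin N → ((Fin N → ℝ) × ℝ) → ℝ)
    (hpLip : ∀ i, ∃ K : NNReal, LipschitzOnWith K (p i) (closure (Ka a) ×ˢ Set.Icc 0 T))
    (hp : ∀ i, ∀ z ∈ closure (Ka a) ×ˢ Set.Icc 0 T, 2 * N / (N + 2) < p i z)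
    -- `|∂_t p_i| ≤ L` a.e. in `Q_T`, expressed as Lipschitz continuity in time
    (hpt : ∀ i, ∀ x ∈ closure (Ka a), ∀ t ∈ Set.Icc 0 T, ∀ s ∈ Set.Icc 0 T,
      |p i (x, t) - p i (x, s)| ≤ L * |t - s|) :
    ∀ ρ ∈ Set.Ioo (0 : ℝ) 1,
    ∃ C C' : ℝ, 0 < C ∧ 0 < C' ∧
      ∀ ε ∈ Set.Ioo (0 : ℝ) 1,
      ∀ f : (Fin N → ℝ) → ℝ → ℝ,
        ContDiffOn ℝ (⊤ : ℕ∞) (fun z : (Fin N → ℝ) × ℝ => f z.1 z.2)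
          (closure (Ka a) ×ˢ Set.Icc 0 T) →
      ∀ u : (Fin N → ℝ) → ℝ → ℝ,
        ContDiffOn ℝ (⊤ : ℕ∞) (fun z : (Fin N → ℝ) × ℝ => u z.1 z.2)
          (closure (Ka a) ×ˢ Set.Icc 0 T) →
        (∀ x ∈ frontier (Ka a), ∀ t ∈ Set.Icc 0 T, u x t = 0) →
        (∀ x ∈ Ka a, ∀ t ∈ Set.Ioo 0 T,
          deriv (fun τ => u x τ) t =
            (∑ j, Dop j (fun y =>
              (ε ^ 2 + (Dop j (fun y' => u y' t) y) ^ 2) ^ ((p j (y, t) - 2) / 2) *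
                Dop j (fun y' => u y' t) y) x) + f x t) →
      -- the supremum in `t` of each summand is expressed by an arbitrary choice
      -- of times `τ i ∈ (0,T)`
      ∀ τ : Fin N → ℝ, (∀ i, τ i ∈ Set.Ioo 0 T) →
        (∫ t in Set.Ioo 0 T, ∫ x in Ka a, (deriv (fun s => u x s) t) ^ 2) +
          (∑ i, ∫ x in Ka a, (1 / p i (x, τ i)) *
            (ε ^ 2 + (Dop i (fun y => u y (τ i)) x) ^ 2) ^ (p i (x, τ i) / 2)) ≤
        C * (1 + (∫ t in Set.Ioo 0 T, ∫ x in Ka a, (f x t) ^ 2) +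
            ∑ i, ∫ x in Ka a, |Dop i (fun y => u y 0) x| ^ (p i (x, 0))) +
          C' * ∑ i, ∫ t in Set.Ioo 0 T, ∫ x in Ka a,
            |Dop i (fun y => u y t) x| ^ (p i (x, t) + ρ) := by
  intro ρ hρ
  have hpc : ∀ j, ContinuousOn (p j) (SS a T) := fun j => (hpLip j).choose_spec.continuousOn
  have hp1 : ∀ i, ∀ z ∈ SS a T, 1 ≤ p i z := by
    intro i z hz
    refine le_trans ?_ (hp i z hz).le
    have : (2 : ℝ) ≤ N := by exact_mod_cast hN
    rw [le_div_iff₀ (by linarith)]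
    linarith
  have hpos : ∀ j, ∀ z ∈ SS a T, 0 < p j z := fun j z hz => lt_of_lt_of_le one_pos (hp1 j z hz)
  choose B hB using fun i => (SS_compact a T).exists_bound_of_continuousOn (hpc i)
  obtain ⟨P, hP⟩ : ∃ P : ℝ, ∀ i, ∀ z ∈ SS a T, p i z ≤ P := by
    refine ⟨∑ i, |B i|, fun i z hz => ?_⟩
    refine ((le_abs_self _).trans (hB i z hz)).trans ((le_abs_self _).trans ?_)
    exact Finset.single_le_sum (f := fun i => |B i|) (fun j _ => abs_nonneg _) (Finset.mem_univ i)
  set A : ℝ := 2 ^ P with hA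
  have hA0 : 0 < A := by positivity
  set C1 : ℝ := 3 + (1 + 1 / ρ) * 2 ^ (P + 1) with hC1
  have hρ0 := hρ.1
  have hC10 : 0 < C1 := by positivity
  set V : ℝ := volume.real (Ka a) with hV
  have hV0 : 0 ≤ V := measureReal_nonneg
  refine ⟨(N + 2) * (A * N * V + A + 1 + L * C1 * N * T * V), (N + 2) * (L * C1) + 1,
    by positivity, by positivity, ?_⟩
  intro ε hε f hf u hu hu0 hpde τ hτ
  have hε0 := hε.1
  -- transfer to derivatives within the cylinder
  set v : (Fin N → ℝ) × ℝ → ℝ := fun z => u z.1 z.2 with hvdef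
  set f' : (Fin N → ℝ) × ℝ → ℝ := fun z => f z.1 z.2 with hfdef
  have hv : ContDiffOn ℝ (⊤ : ℕ∞) v (SS a T) := hu
  have hfc : ContinuousOn f' (SS a T) := hf.continuousOn
  have eD : ∀ j, ∀ x ∈ Ka a, ∀ t ∈ Set.Icc 0 T,
      Dop j (fun y => u y t) x = Dv a T v (ej j) (x, t) := by
    intro j x hx t ht
    have h := (Dv_space a hv hx ht).fderiv
    have h2 : Dop j (fun y => u y t) x = fderiv ℝ (fun y => v (y, t)) x (Pi.single j 1) := rfl
    rw [h2, h]
    rfl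
  have et : ∀ x ∈ Ka a, ∀ t ∈ Set.Ioo 0 T,
      deriv (fun s => u x s) t = Dv a T v (0, 1) (x, t) := by
    intro x hx t ht
    exact (Dv_time a hv (subset_closure hx) ht).deriv
  have hpde' : ∀ t ∈ Set.Ioo 0 T, ∀ x ∈ Ka a, Dv a T v (0, 1) (x, t) =
      (∑ j, fderiv ℝ (fun y => Flux ε (p j (y, t)) (Dv a T v (ej j) (y, t))) x (Pi.single j 1))
        + f' (x, t) := by
    intro t ht x hx
    rw [← et x hx t ht, hpde x hx t ht]
    congr 1
    refine Finset.sum_congr rfl fun j _ => ?_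
    unfold Dop
    congr 1
    apply Filter.EventuallyEq.fderiv_eq
    filter_upwards [(Ka_open a).mem_nhds hx] with y hy
    have := eD j y hy t (Set.Ioo_subset_Icc_self ht)
    unfold Dop at this
    rw [this]
    rfl
  have hD := fun j => (Dv_contDiffOn a ha hT hv (ej j)).continuousOn
  have hDt := (Dv_contDiffOn a ha hT hv (0, 1)).continuousOn
  have h0I : (0 : ℝ) ∈ Set.Icc 0 T := ⟨le_rfl, hT.le⟩
  have r1 : ∫ t in Set.Ioo 0 T, ∫ x in Ka a, (deriv (fun s => u x s) t) ^ 2 =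
      ∫ t in Set.Ioo 0 T, ∫ x in Ka a, Dv a T v (0, 1) (x, t) ^ 2 := by
    refine setIntegral_congr_fun measurableSet_Ioo fun t ht => ?_
    refine setIntegral_congr_fun (Ka_open a).measurableSet fun x hx => ?_
    try simp only
    rw [et x hx t ht]
  have r2 : ∀ i, ∫ x in Ka a, (1 / p i (x, τ i)) *
        (ε ^ 2 + (Dop i (fun y => u y (τ i)) x) ^ 2) ^ (p i (x, τ i) / 2) =
      ∫ x in Ka a, Phi ε (p i (x, τ i)) (Dv a T v (ej i) (x, τ i)) := by
    intro i
    refine setIntegral_congr_fun (Ka_open a).measurableSet fun x hx => ?_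
    try simp only
    rw [eD i x hx _ (Set.Ioo_subset_Icc_self (hτ i))]
    rfl
  have r3 : ∀ i, ∫ x in Ka a, |Dop i (fun y => u y 0) x| ^ (p i (x, 0)) =
      ∫ x in Ka a, |Dv a T v (ej i) (x, 0)| ^ (p i (x, 0)) := by
    intro i
    refine setIntegral_congr_fun (Ka_open a).measurableSet fun x hx => ?_
    try simp only
    rw [eD i x hx _ h0I]
  have r4 : ∀ i, ∫ t in Set.Ioo 0 T, ∫ x in Ka a, |Dop i (fun y => u y t) x| ^ (p i (x, t) + ρ) =
      ∫ t in Set.Ioo 0 T, ∫ x in Ka a, |Dv a T v (ej i) (x, t)| ^ (p i (x, t) + ρ) := by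
    intro i
    refine setIntegral_congr_fun measurableSet_Ioo fun t ht => ?_
    refine setIntegral_congr_fun (Ka_open a).measurableSet fun x hx => ?_
    try simp only
    rw [eD i x hx t (Set.Ioo_subset_Icc_self ht)]
  rw [r1, Finset.sum_congr rfl (fun i _ => r2 i), Finset.sum_congr rfl (fun i _ => r3 i),
    Finset.sum_congr rfl (fun i _ => r4 i)]
  -- continuity facts
  have c1 : ∀ i, ContinuousOn (fun z => |Dv a T v (ej i) z| ^ (p i z)) (SS a T) := fun i =>
    (hD i).abs.rpow (hpc i) (fun z hz => Or.inr (hpos i z hz))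
  have c2 : ∀ i, ContinuousOn (fun z => |Dv a T v (ej i) z| ^ (p i z + ρ)) (SS a T) := fun i =>
    (hD i).abs.rpow ((hpc i).add continuousOn_const)
      (fun z hz => Or.inr (by linarith [hpos i z hz]))
  have c3 : ∀ i, ContinuousOn (fun z => Phi ε (p i z) (Dv a T v (ej i) z)) (SS a T) := fun i =>
    continuousOn_Phi hε0 (hpc i) (hD i) (hpos i)
  have c4 : ∀ i, ContinuousOn (fun z => |PhiQ ε (p i z) (Dv a T v (ej i) z)|) (SS a T) := fun i =>
    (continuousOn_PhiQ hε0 (hpc i) (hD i) (hpos i)).abs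
  have c5 : ContinuousOn (fun _ : (Fin N → ℝ) × ℝ => (1 : ℝ)) (SS a T) := continuousOn_const
  have hen := fun s (hs : s ∈ Set.Ioc 0 T) =>
    energy a ha hT hL hpLip hp1 hpt hε0 hv hfc hu0 hpde' hs
  set F : ℝ := ∫ t in Set.Ioo 0 T, ∫ x in Ka a, f x t ^ 2 with hF
  set U : ℝ := ∫ t in Set.Ioo 0 T, ∫ x in Ka a, Dv a T v (0, 1) (x, t) ^ 2 with hU
  set E0 : ℝ := ∑ j, ∫ x in Ka a, Phi ε (p j (x, 0)) (Dv a T v (ej j) (x, 0)) with hE0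
  set Q : ℝ := ∑ j, ∫ t in Set.Ioo 0 T, ∫ x in Ka a,
        |PhiQ ε (p j (x, t)) (Dv a T v (ej j) (x, t))| with hQ
  set I0 : ℝ := ∑ i, ∫ x in Ka a, |Dv a T v (ej i) (x, 0)| ^ (p i (x, 0)) with hI0
  set J : ℝ := ∑ i, ∫ t in Set.Ioo 0 T, ∫ x in Ka a,
    |Dv a T v (ej i) (x, t)| ^ (p i (x, t) + ρ) with hJ
  have F0 : 0 ≤ F := integral_nonneg fun t => integral_nonneg fun x => sq_nonneg _
  have I00 : 0 ≤ I0 := Finset.sum_nonneg fun i _ => integral_nonneg fun x => by positivity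
  have J0 : 0 ≤ J := Finset.sum_nonneg fun i _ => integral_nonneg fun t =>
    integral_nonneg fun x => by positivity
  have Phi0 : ∀ i, ∀ s ∈ Set.Icc 0 T,
      0 ≤ ∫ x in Ka a, Phi ε (p i (x, s)) (Dv a T v (ej i) (x, s)) := by
    intro i s hs
    refine setIntegral_nonneg (Ka_open a).measurableSet fun x hx => ?_
    exact Phi_nonneg hε0 (hpos i _ ⟨subset_closure hx, hs⟩)
  -- bounds
  have b1 : E0 ≤ A * (N * V + I0) := by
    have : ∀ i, ∫ x in Ka a, Phi ε (p i (x, 0)) (Dv a T v (ej i) (x, 0)) ≤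
        A * (V + ∫ x in Ka a, |Dv a T v (ej i) (x, 0)| ^ (p i (x, 0))) := by
      intro i
      have e : V + ∫ x in Ka a, |Dv a T v (ej i) (x, 0)| ^ (p i (x, 0)) =
          ∫ x in Ka a, (1 + |Dv a T v (ej i) (x, 0)| ^ (p i (x, 0))) := by
        rw [integral_add (slice_int a c5 h0I) (slice_int a (c1 i) h0I), setIntegral_const]
        simp [hV]
      rw [e, ← integral_const_mul]
      refine setIntegral_mono_on (slice_int a (c3 i) h0I)
        (((slice_int a c5 h0I).add (slice_int a (c1 i) h0I)).const_mul A)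
        (Ka_open a).measurableSet fun x hx => ?_
      have hz : (x, (0 : ℝ)) ∈ SS a T := ⟨subset_closure hx, h0I⟩
      exact Phi_bound hε (hp1 i _ hz) (hP i _ hz)
    refine (Finset.sum_le_sum fun i _ => this i).trans (le_of_eq ?_)
    rw [← Finset.mul_sum, Finset.sum_add_distrib]
    simp [hI0]
  have b2 : Q ≤ C1 * (N * (T * V) + J) := by
    have : ∀ i, ∫ t in Set.Ioo 0 T, ∫ x in Ka a,
        |PhiQ ε (p i (x, t)) (Dv a T v (ej i) (x, t))| ≤
        C1 * (T * V + ∫ t in Set.Ioo 0 T, ∫ x in Ka a,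
          |Dv a T v (ej i) (x, t)| ^ (p i (x, t) + ρ)) := by
      intro i
      have e1 : ∀ t ∈ Set.Icc 0 T, ∫ x in Ka a, |PhiQ ε (p i (x, t)) (Dv a T v (ej i) (x, t))| ≤
          C1 * (V + ∫ x in Ka a, |Dv a T v (ej i) (x, t)| ^ (p i (x, t) + ρ)) := by
        intro t ht
        have e : V + ∫ x in Ka a, |Dv a T v (ej i) (x, t)| ^ (p i (x, t) + ρ) =
            ∫ x in Ka a, (1 + |Dv a T v (ej i) (x, t)| ^ (p i (x, t) + ρ)) := by
          rw [integral_add (slice_int a c5 ht) (slice_int a (c2 i) ht), setIntegral_const]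
          simp [hV]
        rw [e, ← integral_const_mul]
        refine setIntegral_mono_on (slice_int a (c4 i) ht)
          (((slice_int a c5 ht).add (slice_int a (c2 i) ht)).const_mul C1)
          (Ka_open a).measurableSet fun x hx => ?_
        have hz : (x, t) ∈ SS a T := ⟨subset_closure hx, ht⟩
        exact PhiQ_bound hε hρ (hp1 i _ hz) (hP i _ hz)
      have hVi : IntegrableOn (fun _ : ℝ => V) (Set.Ioo 0 T) := by
        simp [integrableOn_const_iff]
      have e2 : T * V + ∫ t in Set.Ioo 0 T, ∫ x in Ka a,
          |Dv a T v (ej i) (x, t)| ^ (p i (x, t) + ρ) = ∫ t in Set.Ioo 0 T, (V + ∫ x in Ka a,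
          |Dv a T v (ej i) (x, t)| ^ (p i (x, t) + ρ)) := by
        rw [integral_add hVi (outer_int a le_rfl (c2 i)), setIntegral_const]
        simp [hT.le]
      rw [e2, ← integral_const_mul]
      exact setIntegral_mono_on (outer_int a le_rfl (c4 i))
        ((hVi.add (outer_int a le_rfl (c2 i))).const_mul C1) measurableSet_Ioo
        fun t ht => e1 t (Set.Ioo_subset_Icc_self ht)
    refine (Finset.sum_le_sum fun i _ => this i).trans (le_of_eq ?_)
    rw [← Finset.mul_sum, Finset.sum_add_distrib]
    simp [hJ]
  -- conclusion
  set R : ℝ := E0 + 1 / 2 * F + L * Q with hR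
  have d1 : U ≤ 2 * R := by
    have h := hen T ⟨hT, le_rfl⟩
    have h2 : 0 ≤ ∑ j, ∫ x in Ka a, Phi ε (p j (x, T)) (Dv a T v (ej j) (x, T)) :=
      Finset.sum_nonneg fun j _ => Phi0 j T ⟨hT.le, le_rfl⟩
    linarith
  have d2 : ∑ i, ∫ x in Ka a, Phi ε (p i (x, τ i)) (Dv a T v (ej i) (x, τ i)) ≤ N * R := by
    have : ∀ i ∈ Finset.univ,
        ∫ x in Ka a, Phi ε (p i (x, τ i)) (Dv a T v (ej i) (x, τ i)) ≤ R := by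
      intro i _
      have h := hen (τ i) ⟨(hτ i).1, (hτ i).2.le⟩
      have h2 := Finset.single_le_sum
        (f := fun j => ∫ x in Ka a, Phi ε (p j (x, τ i)) (Dv a T v (ej j) (x, τ i)))
        (fun j _ => Phi0 j (τ i) (Set.Ioo_subset_Icc_self (hτ i))) (Finset.mem_univ i)
      have h3 : 0 ≤ ∫ t in Set.Ioo 0 (τ i), ∫ x in Ka a, Dv a T v (0, 1) (x, t) ^ 2 :=
        integral_nonneg fun t => integral_nonneg fun x => sq_nonneg _
      linarith
    refine (Finset.sum_le_sum this).trans (le_of_eq ?_)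
    simp
  have b3 := mul_le_mul_of_nonneg_left b2 hL
  have d3 : R ≤ (A * N * V + A + 1 + L * C1 * N * T * V) * (1 + F + I0) + L * C1 * J := by
    have g1 : 0 ≤ A * N * V := by positivity
    have g2 : 0 ≤ L * C1 * N * T * V := by positivity
    have g3 := mul_nonneg g1 F0
    have g4 := mul_nonneg g1 I00
    have g5 := mul_nonneg g2 F0
    have g6 := mul_nonneg g2 I00
    have g7 := mul_nonneg hA0.le F0
    linarith
  have hN0 : (0 : ℝ) ≤ N + 2 := by positivity
  have d4 := mul_le_mul_of_nonneg_left d3 hN0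
  linarith
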